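/- (Weak Poisson summation formula.) Let f ∈ L¹(ℝⁿ) and let L be an invertible real n×n matrix. Then the Poisson identity Σ_{κ∈ℤⁿ} f(x+Lκ) = (1/|det L|) Σ_{κ∈ℤⁿ} f̂(L^{−T}κ) e^{2πi L^{−T}κ·x} holds in the sense of tempered distributions: for every Schwartz function φ on ℝⁿ, ∫_{ℝⁿ} F_L(x) φ(x) dx = (1/|det L|) lim_{h→+∞} Σ_{|κ|≤h} f̂(L^{−T}κ) φ̂(−L^{−T}κ), where F_L(x) = Σ_{κ∈ℤⁿ} f(x+Lκ) is the L-periodization of f (absolutely convergent a.e.), and L^{−T} := (L^{−1})^T. -/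

import Mathlib

open MeasureTheory Matrix Filter
open scoped ENNReal NNReal

noncomputable section

/-- `ℝⁿ` with the Euclidean norm. -/
abbrev Euc (n : ℕ) := EuclideanSpace ℝ (Fin n)

/-- Turn a plain vector into a point of Euclidean space. -/
def toE {n : ℕ} (x : Fin n → ℝ) : Euc n := (EuclideanSpace.equiv (Fin n) ℝ).symm x

/-- `e^{2πit}`. -/
def e2 (t : ℝ) : ℂ := Complex.exp (2 * Real.pi * Complex.I * t)

/-- The dot product `x·ω = ∑ⱼ xⱼωⱼ`. -/
def dotE {n : ℕ} (x y : Euc n) : ℝ := ∑ j, x j * y j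

/-- The Fourier transform `f̂(ω) = ∫ f(x) e^{-2πi x·ω} dx`. -/
def FT {n : ℕ} (f : Euc n → ℂ) (ω : Euc n) : ℂ := ∫ x : Euc n, f x * e2 (-(dotE x ω))

/-- The lattice point `Lκ` for `κ ∈ ℤⁿ`. -/
def latVec {n : ℕ} (L : Matrix (Fin n) (Fin n) ℝ) (κ : Fin n → ℤ) : Euc n :=
  toE (L.mulVec fun i => (κ i : ℝ))

/-- The `L`-periodization `F_L(x) = ∑_{κ∈ℤⁿ} f(x+Lκ)`. -/
def periodization {n : ℕ} (L : Matrix (Fin n) (Fin n) ℝ) (f : Euc n → ℂ) (x : Euc n) : ℂ :=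
  ∑' κ : Fin n → ℤ, f (x + latVec L κ)

open Topology in
lemma aux_summable (n : ℕ) : ∃ N : ℕ, Summable (fun κ : Fin n → ℤ => ((1 + ‖(fun i => (κ i : ℝ))‖) ^ N)⁻¹) := by
  let Λ := Submodule.span ℤ (Set.range (Pi.basisFun ℝ (Fin n)))
  let N := Module.finrank ℤ Λ + 1
  refine ⟨N, ?_⟩
  have h1 := ZLattice.summable_norm_pow_inv Λ N (Nat.lt_succ_self _)
  have hmem : ∀ κ : Fin n → ℤ, (fun i => (κ i : ℝ)) ∈ Λ := by
    intro κ
    have : (fun i => (κ i : ℝ)) = ∑ i, κ i • (Pi.basisFun ℝ (Fin n) i) := by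
      ext j
      simp [Finset.sum_apply, Pi.single_apply]
    rw [this]
    exact Submodule.sum_mem _ fun i _ => Submodule.smul_mem _ _ (Submodule.subset_span ⟨i, rfl⟩)
  have hinj : Function.Injective (fun κ : Fin n → ℤ => (⟨_, hmem κ⟩ : Λ)) := by
    intro a b hab
    have := congrArg Subtype.val hab
    ext i
    have : (a i : ℝ) = b i := congrFun this i
    exact_mod_cast this
  have h2 := h1.comp_injective hinj
  refine Summable.of_norm_bounded_eventually h2 ?_
  refine ((Set.finite_singleton (0 : Fin n → ℤ)).subset ?_)
  intro κ hκ
  by_contra h0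
  apply hκ
  have hpos : 0 < ‖(fun i => (κ i : ℝ))‖ := by
    rw [norm_pos_iff]
    intro h
    apply h0
    ext i
    have := congrFun h i
    simpa using this
  have hh : ‖((1 + ‖(fun i => (κ i : ℝ))‖) ^ N)⁻¹‖ ≤ (‖(fun i => (κ i : ℝ))‖ ^ N)⁻¹ := by
    rw [norm_inv, norm_pow, Real.norm_of_nonneg (by positivity)]
    gcongr
    linarith
  simp only [Set.mem_ofPred_eq, Function.comp]
  rw [inv_pow]
  exact hh

lemma toE_norm_le {n : ℕ} (A : Matrix (Fin n) (Fin n) ℝ) (hA : IsUnit A.det) :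
    ∃ c : ℝ, 1 ≤ c ∧ ∀ v : Fin n → ℝ, ‖v‖ ≤ c * ‖toE (A.mulVec v)‖ := by
  let T : Euc n →L[ℝ] (Fin n → ℝ) :=
    (LinearMap.toContinuousLinearMap (Matrix.toLin' A⁻¹)).comp
      (EuclideanSpace.equiv (Fin n) ℝ : Euc n →L[ℝ] (Fin n → ℝ))
  refine ⟨max 1 ‖T‖, le_max_left _ _, fun v => ?_⟩
  have : v = T (toE (A.mulVec v)) := by
    change v = A⁻¹.mulVec (A.mulVec v)
    rw [Matrix.mulVec_mulVec, Matrix.nonsing_inv_mul _ hA, Matrix.one_mulVec]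
  calc ‖v‖ = ‖T (toE (A.mulVec v))‖ := by rw [← this]
    _ ≤ ‖T‖ * ‖toE (A.mulVec v)‖ := T.le_opNorm _
    _ ≤ _ := by gcongr; exact le_max_right _ _

lemma schwartz_bound {n : ℕ} (A : Matrix (Fin n) (Fin n) ℝ) (hA : IsUnit A.det)
    (φ : SchwartzMap (Euc n) ℂ) (R : ℝ) (hR : 0 ≤ R) :
    ∃ u : (Fin n → ℤ) → ℝ, Summable u ∧ ∀ y : Fin n → ℝ, ‖y‖ ≤ R → ∀ κ : Fin n → ℤ,
      ‖φ (toE (A.mulVec (y + fun i => (κ i : ℝ))))‖ ≤ u κ := by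
  obtain ⟨N, hN⟩ := aux_summable n
  obtain ⟨c, hc1, hc⟩ := toE_norm_le A hA
  have hd := SchwartzMap.one_add_le_sup_seminorm_apply (𝕜 := ℝ) (m := (N, 0)) (k := N) (n := 0)
    le_rfl le_rfl φ
  generalize 2 ^ (N, 0).1 * ((Finset.Iic (N, 0)).sup fun m => SchwartzMap.seminorm ℝ m.1 m.2) φ = C at hd
  refine ⟨fun κ => (((1 + R) * c) ^ N * C) * ((1 + ‖(fun i => (κ i : ℝ))‖) ^ N)⁻¹,
    hN.mul_left _, fun y hy κ => ?_⟩
  have h := hd (toE (A.mulVec (y + fun i => (κ i : ℝ))))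
  rw [norm_iteratedFDeriv_zero] at h
  have h2 := hc (y + fun i => (κ i : ℝ))
  set z := toE (A.mulVec (y + fun i => (κ i : ℝ)))
  set k : Fin n → ℝ := fun i => (κ i : ℝ)
  have h3 : ‖k‖ ≤ ‖y + k‖ + ‖y‖ := by
    calc ‖k‖ = ‖(y + k) - y‖ := by simp
      _ ≤ _ := norm_sub_le _ _
  have h4 : 1 + ‖k‖ ≤ (1 + R) * c * (1 + ‖z‖) := by
    have hz : 0 ≤ ‖z‖ := norm_nonneg _
    have : 1 + ‖y + k‖ ≤ c * (1 + ‖z‖) := by nlinarith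
    have h5 : 0 ≤ ‖y + k‖ := norm_nonneg _
    calc 1 + ‖k‖ ≤ (1 + R) * (1 + ‖y + k‖) := by nlinarith
      _ ≤ (1 + R) * (c * (1 + ‖z‖)) := by gcongr
      _ = _ := by ring
  change ‖φ z‖ ≤ (((1 + R) * c) ^ N * C) * ((1 + ‖k‖) ^ N)⁻¹
  rw [← div_eq_mul_inv, le_div_iff₀ (by positivity)]
  calc ‖φ z‖ * (1 + ‖k‖) ^ N ≤ ‖φ z‖ * ((1 + R) * c * (1 + ‖z‖)) ^ N := by gcongr
    _ = ((1 + R) * c) ^ N * ((1 + ‖z‖) ^ N * ‖φ z‖) := by rw [mul_pow _ (1 + ‖z‖)]; ring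
    _ ≤ _ := by gcongr

lemma box_hasSum {n : ℕ} (h : (Fin n → ℝ) → ℂ) (hh : Integrable h) :
    HasSum (fun κ : Fin n → ℤ => ∫ x in {x : Fin n → ℝ | ∀ i, x i ∈ Set.Ioc (0:ℝ) (0 + 1)},
      h (x + fun i => (κ i : ℝ))) (∫ x, h x) := by
  let s : (Fin n → ℤ) → Set (Fin n → ℝ) := fun κ =>
    {x | ∀ i, x i - κ i ∈ Set.Ioc (0:ℝ) (0 + 1)}
  have hu : (⋃ κ, s κ) = Set.univ := by
    ext x
    simp only [Set.mem_iUnion, Set.mem_univ, iff_true]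
    refine ⟨fun i => ⌈x i⌉ - 1, fun i => ?_⟩
    have := Int.ceil_lt_add_one (x i)
    have := Int.le_ceil (x i)
    constructor <;> push_cast <;> linarith
  have hm : ∀ κ, MeasurableSet (s κ) := by
    intro κ
    simp only [s, Set.ofPred_forall]
    refine MeasurableSet.iInter fun i => ?_
    exact ((measurable_pi_apply i).sub_const _) measurableSet_Ioc
  have hd : Pairwise (Function.onFun Disjoint s) := by
    intro a b hab
    refine Set.disjoint_left.2 fun x hx hy => hab ?_
    ext i
    have h1 := hx i
    have h2 := hy i
    simp only [Set.mem_Ioc, zero_add] at h1 h2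
    have h3 : ((a i : ℤ) : ℝ) < (b i + 1 : ℤ) := by push_cast; linarith
    have h4 : ((b i : ℤ) : ℝ) < (a i + 1 : ℤ) := by push_cast; linarith
    have h3 := Int.cast_lt.1 h3
    have h4 := Int.cast_lt.1 h4
    omega
  have := hasSum_integral_iUnion (f := h) hm hd hh.integrableOn
  rw [hu, setIntegral_univ] at this
  refine HasSum.congr_fun this (fun κ => ?_)
  have hp : MeasurePreserving (fun x : Fin n → ℝ => x + fun i => (κ i : ℝ)) volume volume :=
    measurePreserving_add_right _ _
  have := hp.setIntegral_preimage_emb (MeasurableEquiv.addRight _).measurableEmbedding h (s κ)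
  rw [← this]
  congr 2
  ext x
  simp [s]

lemma e2_eq (t : ℝ) : ‖e2 t‖ = 1 := by
  rw [e2, show (2 * Real.pi * Complex.I * t : ℂ) = ((2 * Real.pi * t : ℝ) : ℂ) * Complex.I by push_cast; ring]
  exact Complex.norm_exp_ofReal_mul_I _

lemma e2_add (s t : ℝ) : e2 (s + t) = e2 s * e2 t := by
  rw [e2, e2, e2, ← Complex.exp_add]; congr 1; push_cast; ring

lemma e2_int (k : ℤ) : e2 k = 1 := by
  rw [e2, Complex.exp_eq_one_iff]
  exact ⟨k, by push_cast; ring⟩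

lemma e2_cont : Continuous e2 := by
  unfold e2; fun_prop

lemma mFourier_e2 {n : ℕ} (m : Fin n → ℤ) (y : Fin n → ℝ) :
    UnitAddTorus.mFourier m (fun i => (y i : UnitAddCircle)) = e2 (∑ i, m i * y i) := by
  simp only [UnitAddTorus.mFourier, ContinuousMap.coe_mk, fourier_coe_apply, e2]
  rw [← Complex.exp_sum]
  congr 1
  push_cast
  rw [Finset.mul_sum]
  refine Finset.sum_congr rfl fun i _ => ?_
  ring

lemma poisson_pi {n : ℕ} (g : (Fin n → ℝ) → ℂ) (hgc : Continuous g) (hgi : Integrable g)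
    (hb : ∀ R : ℝ, 0 ≤ R → ∃ u : (Fin n → ℤ) → ℝ, Summable u ∧ ∀ y : Fin n → ℝ, ‖y‖ ≤ R →
      ∀ κ : Fin n → ℤ, ‖g (y + fun i => (κ i : ℝ))‖ ≤ u κ)
    (hs : Summable (fun m : Fin n → ℤ => ∫ y, g y * e2 (-(∑ i, m i * y i)))) (y : Fin n → ℝ) :
    HasSum (fun m : Fin n → ℤ => (∫ y, g y * e2 (-(∑ i, m i * y i))) * e2 (∑ i, m i * y i))
      (∑' κ : Fin n → ℤ, g (y + fun i => (κ i : ℝ))) := by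
  let P : (Fin n → ℝ) → ℂ := fun y => ∑' κ : Fin n → ℤ, g (y + fun i => (κ i : ℝ))
  have hPc : Continuous P := by
    rw [continuous_iff_continuousAt]
    intro y0
    obtain ⟨u, hu, hub⟩ := hb (‖y0‖ + 1) (by positivity)
    have : ContinuousOn P (Metric.ball y0 1) := by
      refine continuousOn_tsum (u := u) (fun κ => ?_) hu ?_
      · exact (hgc.comp (by fun_prop)).continuousOn
      · intro κ x hx
        refine hub x ?_ κ
        rw [mem_ball_iff_norm] at hx
        have := norm_add_le (x - y0) y0
        simp only [sub_add_cancel] at this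
        linarith
    exact this.continuousAt (Metric.ball_mem_nhds _ one_pos)
  have hPp : ∀ (y : Fin n → ℝ) (κ : Fin n → ℤ), P (y + fun i => (κ i : ℝ)) = P y := by
    intro y κ
    simp only [P]
    rw [← (Equiv.addLeft κ).tsum_eq (fun κ' : Fin n → ℤ => g (y + fun i => (κ' i : ℝ)))]
    refine tsum_congr fun κ' => ?_
    congr 1
    ext i
    simp [add_assoc]
  let π : (Fin n → ℝ) → UnitAddTorus (Fin n) := fun y i => (y i : UnitAddCircle)
  have hπ : IsOpenQuotientMap π :=
    IsOpenQuotientMap.piMap (f := fun (_ : Fin n) (x : ℝ) => (x : UnitAddCircle)) fun i =>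
      QuotientAddGroup.isOpenQuotientMap_mk
  have hfac : ∀ y y', π y = π y' → P y = P y' := by
    intro y y' h
    have : ∀ i, ∃ k : ℤ, y' i = y i + k := by
      intro i
      have h1 := congrFun h i
      simp only [π] at h1
      have h2 : ((y' i - y i : ℝ) : UnitAddCircle) = 0 := by
        rw [AddCircle.coe_sub, h1, sub_self]
      obtain ⟨k, hk⟩ := (AddCircle.coe_eq_zero_iff (1:ℝ)).1 h2
      refine ⟨k, ?_⟩
      simp only [zsmul_eq_mul, mul_one] at hk
      linarith
    choose k hk using this
    rw [← hPp y k]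
    congr 1
    ext i
    simp [hk]
  let G0 : UnitAddTorus (Fin n) → ℂ := fun t => P (Function.surjInv hπ.surjective t)
  have hG0 : ∀ y, G0 (π y) = P y := fun y => hfac _ _ (Function.surjInv_eq hπ.surjective _)
  have hGc : Continuous G0 := by
    rw [hπ.isQuotientMap.continuous_iff]
    convert hPc using 1
    ext y; exact hG0 y
  let G : C(UnitAddTorus (Fin n), ℂ) := ⟨G0, hGc⟩
  have hint : ∀ m : Fin n → ℤ, Integrable (fun y => g y * e2 (-(∑ i, m i * y i))) := by
    intro m
    refine hgi.mul_bdd (c := 1) (Continuous.aestronglyMeasurable (e2_cont.comp (by fun_prop))) ?_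
    exact Eventually.of_forall fun y => (e2_eq _).le
  have hcoef : ∀ m : Fin n → ℤ, UnitAddTorus.mFourierCoeff G m =
      ∫ y, g y * e2 (-(∑ i, m i * y i)) := by
    intro m
    rw [UnitAddTorus.mFourierCoeff_eq_integral _ _ (fun _ => 0)]
    rw [← (box_hasSum _ (hint m)).tsum_eq]
    set B := {x : Fin n → ℝ | ∀ i, x i ∈ Set.Ioc (0:ℝ) (0 + 1)} with hB
    have hBm : MeasurableSet B := by
      simp only [B, Set.ofPred_forall]
      exact MeasurableSet.iInter fun i => (measurable_pi_apply i) measurableSet_Ioc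
    have hBv : volume B = 1 := by
      have : B = Set.pi Set.univ (fun _ => Set.Ioc (0:ℝ) (0 + 1)) := by ext; simp [B]
      rw [this, Real.volume_pi_Ioc]; simp
    have : IsFiniteMeasure (volume.restrict B) := ⟨by simp [hBv]⟩
    obtain ⟨u, hu, hub⟩ := hb 1 zero_le_one
    have hBb : ∀ x ∈ B, ‖x‖ ≤ 1 := by
      intro x hx
      rw [pi_norm_le_iff_of_nonneg zero_le_one]
      intro i
      have := hx i
      simp only [Set.mem_Ioc, zero_add] at this
      rw [Real.norm_eq_abs, abs_le]
      constructor <;> linarith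
    have hbd : ∀ κ : Fin n → ℤ, ∀ x ∈ B, ‖g (x + fun i => (κ i : ℝ)) *
        e2 (-(∑ i, m i * (x + fun i => (κ i : ℝ)) i))‖ ≤ u κ := by
      intro κ x hx
      rw [norm_mul, e2_eq, mul_one]
      exact hub x (hBb x hx) κ
    have hi : ∀ κ : Fin n → ℤ, Integrable (fun x : Fin n → ℝ => g (x + fun i => (κ i : ℝ)) *
        e2 (-(∑ i, m i * (x + fun i => (κ i : ℝ)) i))) (volume.restrict B) := by
      intro κ
      exact ((hint m).comp_add_right _).integrableOn
    have := (hasSum_integral_of_summable_integral_norm hi ?_).tsum_eq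
    · rw [this]
      refine setIntegral_congr_fun hBm fun x hx => ?_
      have hx' : G (fun i => (x i : UnitAddCircle)) = P x := hG0 x
      rw [hx', mFourier_e2]
      simp only [P, smul_eq_mul]
      rw [← tsum_mul_left]
      refine tsum_congr fun κ => ?_
      rw [mul_comm]
      congr 1
      have : -(∑ i, (m i : ℝ) * (x + fun i => (κ i : ℝ)) i) =
          (∑ i, ((-m) i : ℤ) * x i) + ((-∑ i, m i * κ i : ℤ) : ℝ) := by
        push_cast
        simp only [Pi.add_apply, mul_add, Finset.sum_add_distrib, Pi.neg_apply]
        simp [Finset.sum_neg_distrib, add_comm]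
      rw [this, e2_add, e2_int, mul_one]
    · refine Summable.of_nonneg_of_le (fun κ => integral_nonneg fun _ => norm_nonneg _) (fun κ => ?_) hu
      calc _ ≤ ∫ x in B, u κ := by
            refine setIntegral_mono_on (hi κ).norm (integrable_const _) hBm (hbd κ)
        _ = u κ := by simp [Measure.real, hBv]
  have hsum : Summable (UnitAddTorus.mFourierCoeff G) := by
    convert hs using 1
    ext m; exact hcoef m
  have := UnitAddTorus.hasSum_mFourier_series_apply_of_summable hsum (π y)
  convert this using 1
  · ext m
    rw [hcoef, smul_eq_mul, mFourier_e2]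
  · exact (hG0 y).symm

lemma emb {n : ℕ} (L : Matrix (Fin n) (Fin n) ℝ) (hL : IsUnit L.det) :
    MeasurableEmbedding (Matrix.toLin' L) := by
  refine Continuous.measurableEmbedding (LinearMap.continuous_of_finiteDimensional _) ?_
  intro a b hab
  have := congrArg (L⁻¹.mulVec) hab
  simpa [Matrix.toLin'_apply, Matrix.mulVec_mulVec, Matrix.nonsing_inv_mul _ hL] using this

lemma cov {n : ℕ} (L : Matrix (Fin n) (Fin n) ℝ) (hL : IsUnit L.det) (h : Euc n → ℂ) :
    ∫ y, h (toE (L.mulVec y)) = ((1 / |L.det| : ℝ) : ℂ) * ∫ x, h x := by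
  have h1 := (PiLp.volume_preserving_toLp (Fin n)).integral_comp
    (MeasurableEquiv.toLp 2 (Fin n → ℝ)).measurableEmbedding h
  have h2 := (emb L hL).integral_map (μ := volume) (fun z => h (toE z))
  rw [Real.map_matrix_volume_pi_eq_smul_volume_pi hL.ne_zero, integral_smul_measure] at h2
  rw [← h1]
  simp only [Matrix.toLin'_apply] at h2
  rw [← h2, ENNReal.toReal_ofReal (abs_nonneg _), Complex.real_smul, abs_inv, one_div]
  rfl

lemma cov_int {n : ℕ} (L : Matrix (Fin n) (Fin n) ℝ) (hL : IsUnit L.det) (h : Euc n → ℂ)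
    (hh : Integrable h) : Integrable (fun y => h (toE (L.mulVec y))) := by
  have h1 : Integrable (fun z => h (toE z)) :=
    ((PiLp.volume_preserving_toLp (Fin n)).integrable_comp_emb
      (MeasurableEquiv.toLp 2 (Fin n → ℝ)).measurableEmbedding).2 hh
  have h2 := (emb L hL).integrable_map_iff (μ := volume) (g := fun z => h (toE z))
  rw [Real.map_matrix_volume_pi_eq_smul_volume_pi hL.ne_zero] at h2
  exact h2.1 (h1.smul_measure ENNReal.ofReal_ne_top)

lemma exists_y {n : ℕ} (L : Matrix (Fin n) (Fin n) ℝ) (hL : IsUnit L.det) (x : Euc n) :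
    ∃ y : Fin n → ℝ, x = toE (L.mulVec y) := by
  refine ⟨L⁻¹.mulVec (EuclideanSpace.equiv (Fin n) ℝ x), ?_⟩
  rw [Matrix.mulVec_mulVec, Matrix.mul_nonsing_inv _ hL, Matrix.one_mulVec]
  rfl

lemma dot_lat {n : ℕ} (L : Matrix (Fin n) (Fin n) ℝ) (hL : IsUnit L.det) (y : Fin n → ℝ)
    (m : Fin n → ℤ) : dotE (toE (L.mulVec y)) (latVec (L⁻¹)ᵀ m) = ∑ i, m i * y i := by
  change (L.mulVec y) ⬝ᵥ ((L⁻¹)ᵀ.mulVec fun i => (m i : ℝ)) = _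
  rw [Matrix.mulVec_transpose, dotProduct_comm, ← Matrix.dotProduct_mulVec, Matrix.mulVec_mulVec,
    Matrix.nonsing_inv_mul _ hL, Matrix.one_mulVec]
  rfl

lemma toE_add {n : ℕ} (a b : Fin n → ℝ) : toE (a + b) = toE a + toE b := rfl

lemma latVec_neg {n : ℕ} (L : Matrix (Fin n) (Fin n) ℝ) (m : Fin n → ℤ) :
    latVec L (-m) = - latVec L m := by
  have : (fun i => (((-m) i : ℤ) : ℝ)) = - (fun i => (m i : ℝ)) := by ext i; simp
  rw [latVec, latVec, this, Matrix.mulVec_neg]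
  rfl

lemma toE_lat {n : ℕ} (L : Matrix (Fin n) (Fin n) ℝ) (y : Fin n → ℝ) (m : Fin n → ℤ) :
    toE (L.mulVec (y + fun i => (m i : ℝ))) = toE (L.mulVec y) + latVec L m := by
  rw [Matrix.mulVec_add]; rfl

lemma FT_eq {n : ℕ} (φ : SchwartzMap (Euc n) ℂ) (w : Euc n) :
    FT (fun x => φ x) w = (FourierTransform.fourier φ : SchwartzMap (Euc n) ℂ) w := by
  rw [SchwartzMap.fourier_coe, Real.fourier_eq', FT]
  congr 1
  ext x
  rw [smul_eq_mul, mul_comm, e2]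
  congr 2
  have : inner ℝ x w = dotE x w := by
    rw [PiLp.inner_apply, dotE]
    exact Finset.sum_congr rfl fun i _ => by simp [mul_comm]
  rw [this]
  push_cast
  ring

lemma FT_summable {n : ℕ} (L : Matrix (Fin n) (Fin n) ℝ) (hL : IsUnit L.det)
    (φ : SchwartzMap (Euc n) ℂ) :
    Summable (fun m : Fin n → ℤ => FT (fun x => φ x) (latVec (L⁻¹)ᵀ m)) := by
  have hA : IsUnit ((L⁻¹)ᵀ).det := by
    rw [Matrix.det_transpose]
    exact Matrix.isUnit_nonsing_inv_det _ hL
  obtain ⟨u, hu, hub⟩ := schwartz_bound _ hA (FourierTransform.fourier φ) 0 le_rfl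
  refine Summable.of_norm_bounded hu fun m => ?_
  rw [FT_eq]
  have := hub 0 (by simp) m
  rwa [zero_add] at this

lemma poisson_schwartz {n : ℕ} (L : Matrix (Fin n) (Fin n) ℝ) (hL : IsUnit L.det)
    (φ : SchwartzMap (Euc n) ℂ) (x : Euc n) :
    ∑' κ : Fin n → ℤ, φ (x - latVec L κ) = ∑' m : Fin n → ℤ, ((1 / |L.det| : ℝ) : ℂ) *
      FT (fun x => φ x) (-latVec (L⁻¹)ᵀ m) * e2 (-dotE x (latVec (L⁻¹)ᵀ m)) := by
  obtain ⟨y, rfl⟩ := exists_y L hL x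
  have hcoef : ∀ m : Fin n → ℤ, ∫ y, φ (toE (L.mulVec y)) * e2 (-(∑ i, m i * y i)) =
      ((1 / |L.det| : ℝ) : ℂ) * FT (fun x => φ x) (latVec (L⁻¹)ᵀ m) := by
    intro m
    rw [FT, ← cov L hL]
    congr 1
    ext y
    rw [dot_lat L hL]
  have h := poisson_pi (fun y => φ (toE (L.mulVec y))) ?_ ?_ ?_ ?_ y
  · simp only [hcoef] at h
    have h' := h.tsum_eq
    rw [← (Equiv.neg (Fin n → ℤ)).tsum_eq, ← (Equiv.neg (Fin n → ℤ)).tsum_eq (fun κ : Fin n → ℤ => φ (toE (L.mulVec (y + fun i => (κ i : ℝ)))))] at h'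
    symm
    convert h' using 1
    · refine tsum_congr fun m => ?_
      simp only [Equiv.neg_apply]
      rw [latVec_neg, dot_lat L hL]
      simp [Finset.sum_neg_distrib]
    · refine tsum_congr fun m => ?_
      simp only [Equiv.neg_apply]
      rw [toE_lat, latVec_neg, sub_eq_add_neg]
  · refine φ.continuous.comp ?_
    exact (EuclideanSpace.equiv (Fin n) ℝ).symm.continuous.comp
      (LinearMap.continuous_of_finiteDimensional (Matrix.toLin' L))
  · exact cov_int L hL _ φ.integrable
  · exact fun R hR => schwartz_bound L hL φ R hR
  · simp only [hcoef]
    exact (FT_summable L hL φ).mul_left _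

lemma unif_bound {n : ℕ} (L : Matrix (Fin n) (Fin n) ℝ) (hL : IsUnit L.det)
    (φ : SchwartzMap (Euc n) ℂ) : ∃ C : ℝ, ∀ (x : Euc n) (s : Finset (Fin n → ℤ)),
      ∑ κ ∈ s, ‖φ (x - latVec L κ)‖ ≤ C := by
  obtain ⟨u, hu, hub⟩ := schwartz_bound L hL φ 1 zero_le_one
  have hu0 : ∀ κ, 0 ≤ u κ := fun κ => (norm_nonneg _).trans (hub 0 (by simp) κ)
  refine ⟨∑' κ, u κ, fun x s => ?_⟩
  obtain ⟨y, rfl⟩ := exists_y L hL x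
  let k : Fin n → ℤ := fun i => ⌊y i⌋
  let t : Fin n → ℝ := fun i => Int.fract (y i)
  have ht : ‖t‖ ≤ 1 := by
    rw [pi_norm_le_iff_of_nonneg zero_le_one]
    intro i
    rw [Real.norm_of_nonneg (Int.fract_nonneg _)]
    exact (Int.fract_lt_one _).le
  have hk : ∀ κ : Fin n → ℤ, toE (L.mulVec y) - latVec L κ =
      toE (L.mulVec (t + fun i => (((Equiv.subLeft k κ) i : ℤ) : ℝ))) := by
    intro κ
    rw [sub_eq_add_neg, ← latVec_neg, ← toE_lat]
    congr 2
    ext i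
    have := Int.fract_add_floor (y i)
    simp only [Pi.add_apply, Pi.neg_apply, Equiv.subLeft_apply, Pi.sub_apply, t, k]
    push_cast
    linarith
  have hsu : Summable (fun κ => u (Equiv.subLeft k κ)) := (Equiv.subLeft k).summable_iff.2 hu
  calc _ ≤ ∑ κ ∈ s, u (Equiv.subLeft k κ) := by
        refine Finset.sum_le_sum fun κ _ => ?_
        rw [hk]
        exact hub t ht _
    _ ≤ ∑' κ, u (Equiv.subLeft k κ) := hsu.sum_le_tsum _ fun κ _ => hu0 _
    _ = _ := (Equiv.subLeft k).tsum_eq u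

lemma main_hasSum {n : ℕ} (L : Matrix (Fin n) (Fin n) ℝ) (hL : IsUnit L.det)
    (f : Euc n → ℂ) (hf : Integrable f) (φ : SchwartzMap (Euc n) ℂ) :
    HasSum (fun m : Fin n → ℤ => ((1 / |L.det| : ℝ) : ℂ) *
      (FT f (latVec (L⁻¹)ᵀ m) * FT (fun x => φ x) (-latVec (L⁻¹)ᵀ m)))
      (∫ x : Euc n, periodization L f x * φ x) := by
  obtain ⟨C, hC⟩ := unif_bound L hL φ
  have hGi : ∀ κ : Fin n → ℤ, Integrable (fun x => f x * φ (x - latVec L κ)) := by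
    intro κ
    refine hf.mul_bdd (c := C) (φ.continuous.comp (by fun_prop)).aestronglyMeasurable ?_
    refine Eventually.of_forall fun x => ?_
    simpa using hC x {κ}
  have hGs : Summable (fun κ : Fin n → ℤ => ∫ x, ‖f x * φ (x - latVec L κ)‖) := by
    refine summable_of_sum_le (c := ∫ x, ‖f x‖ * C) (fun κ => integral_nonneg fun _ => norm_nonneg _) fun s => ?_
    rw [← integral_finsetSum _ fun κ _ => (hGi κ).norm]
    refine integral_mono (integrable_finsetSum _ fun κ _ => (hGi κ).norm) (hf.norm.mul_const _) fun x => ?_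
    simp only [norm_mul, ← Finset.mul_sum]
    exact mul_le_mul_of_nonneg_left (hC x s) (norm_nonneg _)
  have hFG : ∀ κ : Fin n → ℤ, (fun x => f (x + latVec L κ) * φ x) =
      fun x => (fun x => f x * φ (x - latVec L κ)) (x + latVec L κ) := by
    intro κ; ext x; simp
  have h1 := hasSum_integral_of_summable_integral_norm
    (F := fun (κ : Fin n → ℤ) x => f (x + latVec L κ) * φ x) (μ := volume) ?_ ?_
  rotate_left
  · intro κ
    rw [hFG]
    exact (hGi κ).comp_add_right _
  · convert hGs using 2 with κ
    exact (integral_congr_ae (Eventually.of_forall fun x => by simp)).trans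
      (integral_add_right_eq_self (fun x => ‖f x * φ (x - latVec L κ)‖) (latVec L κ))
  have h2 := hasSum_integral_of_summable_integral_norm hGi hGs
  have h3 : ∫ x : Euc n, periodization L f x * φ x = ∫ x, ∑' κ : Fin n → ℤ, f x * φ (x - latVec L κ) := by
    rw [← h2.tsum_eq]
    simp only [periodization, ← tsum_mul_right]
    rw [← h1.tsum_eq]
    refine tsum_congr fun κ => ?_
    rw [hFG κ]
    exact integral_add_right_eq_self (fun x => f x * φ (x - latVec L κ)) (latVec L κ)
  rw [h3]
  simp only [tsum_mul_left, poisson_schwartz L hL φ]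
  simp only [← tsum_mul_left (a := f _)]
  have hnorm : ∀ (m : Fin n → ℤ) (x : Euc n), ‖f x * (((1 / |L.det| : ℝ) : ℂ) *
      FT (fun x => φ x) (-latVec (L⁻¹)ᵀ m) * e2 (-dotE x (latVec (L⁻¹)ᵀ m)))‖ =
      ‖f x‖ * ‖((1 / |L.det| : ℝ) : ℂ) * FT (fun x => φ x) (-latVec (L⁻¹)ᵀ m)‖ := by
    intro m x
    rw [norm_mul, norm_mul _ (e2 _), e2_eq, mul_one]
  have h4 := hasSum_integral_of_summable_integral_norm (μ := volume)
    (F := fun (m : Fin n → ℤ) (x : Euc n) => f x * (((1 / |L.det| : ℝ) : ℂ) *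
      FT (fun x => φ x) (-latVec (L⁻¹)ᵀ m) * e2 (-dotE x (latVec (L⁻¹)ᵀ m)))) ?_ ?_
  · refine HasSum.congr_fun h4 (fun m => ?_)
    rw [show FT f (latVec (L⁻¹)ᵀ m) = ∫ x : Euc n, f x * e2 (-(dotE x (latVec (L⁻¹)ᵀ m))) from rfl,
      ← integral_mul_const, ← integral_const_mul]
    congr 1
    ext x
    ring
  · intro m
    refine hf.mul_bdd (c := ‖((1 / |L.det| : ℝ) : ℂ) * FT (fun x => φ x) (-latVec (L⁻¹)ᵀ m)‖) ?_ ?_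
    · refine Continuous.aestronglyMeasurable ?_
      refine continuous_const.mul (e2_cont.comp ?_)
      unfold dotE
      fun_prop
    · refine Eventually.of_forall fun x => ?_
      rw [norm_mul _ (e2 _), e2_eq, mul_one]
  · simp only [hnorm, integral_mul_const]
    refine Summable.mul_left _ ?_
    have := (((FT_summable L hL φ).mul_left ((1 / |L.det| : ℝ) : ℂ)).comp_injective
      (Equiv.neg (Fin n → ℤ)).injective).norm
    refine this.congr fun m => ?_
    simp only [Function.comp, Equiv.neg_apply, latVec_neg]

/-- weak Poisson summation formula: for `f ∈ L¹(ℝⁿ)` and `L` invertible,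
for every Schwartz function `φ`,
`∫ F_L(x) φ(x) dx = (1/|det L|) lim_{h→∞} ∑_{|κ|≤h} f̂(L^{-T}κ) φ̂(-L^{-T}κ)`. -/
theorem stmt4 {n : ℕ} (L : Matrix (Fin n) (Fin n) ℝ) (hL : IsUnit L.det)
    (f : Euc n → ℂ) (hf : Integrable f) :
    ∀ φ : SchwartzMap (Euc n) ℂ,
      Tendsto
        (fun h : ℕ => ((1 / |L.det| : ℝ) : ℂ) *
          ∑' κ : {κ : Fin n → ℤ // (∑ i, (κ i).natAbs) ≤ h},
            FT f (latVec (L⁻¹)ᵀ κ.1) * FT (fun x => φ x) (-(latVec (L⁻¹)ᵀ κ.1)))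
        atTop (nhds (∫ x : Euc n, periodization L f x * φ x)) := by
  intro φ
  have h := main_hasSum L hL f hf φ
  have hfin : ∀ h : ℕ, {κ : Fin n → ℤ | (∑ i, (κ i).natAbs) ≤ h}.Finite := by
    intro h
    refine (Set.Finite.pi' (t := fun _ : Fin n => Set.Icc (-(h : ℤ)) h)
      fun _ => Set.finite_Icc _ _).subset fun κ hκ i => ?_
    have h1 : (κ i).natAbs ≤ ∑ i, (κ i).natAbs :=
      Finset.single_le_sum (f := fun i => (κ i).natAbs) (fun _ _ => Nat.zero_le _) (Finset.mem_univ i)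
    have h2 : (∑ i, (κ i).natAbs) ≤ h := hκ
    rw [Set.mem_Icc]
    omega
  have ht : Tendsto (fun h : ℕ => (hfin h).toFinset) atTop atTop := by
    refine Filter.tendsto_atTop_finset_of_monotone ?_ ?_
    · intro a b hab κ hκ
      simp only [Set.Finite.mem_toFinset, Set.mem_ofPred_eq] at hκ ⊢
      exact hκ.trans hab
    · intro κ
      exact ⟨∑ i, (κ i).natAbs, by simp⟩
  have h5 := h.comp ht
  refine h5.congr fun k => ?_
  simp only [Function.comp]
  rw [← Finset.mul_sum]
  congr 1
  rw [← Finset.tsum_subtype]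
  exact (Equiv.subtypeEquivRight (fun κ => by simp)).tsum_eq
    (fun κ : {κ : Fin n → ℤ // (∑ i, (κ i).natAbs) ≤ k} =>
      FT f (latVec (L⁻¹)ᵀ κ.1) * FT (fun x => φ x) (-(latVec (L⁻¹)ᵀ κ.1)))
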